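/- Let β > 0, ρ > 0 and let x : [0,∞) → ℝ be continuous (the measured Lorenz state). Suppose (y₁, z₁) and (y₂, z₂) are two differentiable solutions of the reduced-order observer equations ẏ(t) = ρ x(t) - y(t) - x(t) z(t), ż(t) = -β z(t) + x(t) y(t). Then for all t ≥ 0: (y₁(t)-y₂(t))² + (z₁(t)-z₂(t))² ≤ e^{-2·min(1,β)·t} · ( (y₁(0)-y₂(0))² + (z₁(0)-z₂(0))² ). In particular, the observer state converges exponentially to the actual state (y, z) of the Lorenz system, which is a particular solution. -/

import Mathlib

/-- Differential form of Grönwall's inequality on `[0, ∞)`: if `V' ≤ c V`, then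
`V t ≤ exp (c t) V 0`. -/
theorem le_exp_mul_of_hasDerivAt_le {V V' : ℝ → ℝ} {c : ℝ}
    (hV : ∀ t ≥ (0 : ℝ), HasDerivAt V (V' t) t) (hle : ∀ t ≥ (0 : ℝ), V' t ≤ c * V t)
    {t : ℝ} (ht : 0 ≤ t) : V t ≤ Real.exp (c * t) * V 0 := by
  have hW : ∀ s ≥ (0 : ℝ), HasDerivAt (fun s => Real.exp (-c * s) * V s)
      (Real.exp (-c * s) * (V' s - c * V s)) s := by
    intro s hs
    have hexp : HasDerivAt (fun s => Real.exp (-c * s)) (Real.exp (-c * s) * (-c * 1)) s :=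
      ((hasDerivAt_id s).const_mul (-c)).exp
    refine (hexp.mul (hV s hs)).congr_deriv ?_
    ring
  have hanti : AntitoneOn (fun s => Real.exp (-c * s) * V s) (Set.Ici 0) := by
    refine antitoneOn_of_hasDerivWithinAt_nonpos (convex_Ici 0)
      (fun s hs => (hW s hs).continuousAt.continuousWithinAt)
      (fun s hs => (hW s (interior_subset hs)).hasDerivWithinAt) fun s hs => ?_
    exact mul_nonpos_of_nonneg_of_nonpos (Real.exp_pos _).le
      (sub_nonpos.2 (hle s (interior_subset hs)))
  have h : Real.exp (-c * t) * V t ≤ V 0 := by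
    simpa using hanti Set.self_mem_Ici ht ht
  calc V t = Real.exp (c * t) * (Real.exp (-c * t) * V t) := by
        rw [← mul_assoc, ← Real.exp_add]; simp
    _ ≤ Real.exp (c * t) * V 0 := mul_le_mul_of_nonneg_left h (Real.exp_pos _).le

/-- **Contraction of the reduced-order Lorenz observer.**
For the Lorenz system with positive constants `σ, ρ, β` and measured signal `x(t)`, any
two solutions `(y₁,z₁)`, `(y₂,z₂)` of the reduced-order observer
`ẏ = ρx - y - xz`, `ż = -βz + xy` satisfy
`(y₁-y₂)² + (z₁-z₂)² ≤ e^{-2 min(1,β) t} ((y₁(0)-y₂(0))² + (z₁(0)-z₂(0))²)`,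
so the observer state converges exponentially to the actual Lorenz state. -/
theorem lorenz_observer_contraction (β ρ : ℝ) (hβ : 0 < β) (hρ : 0 < ρ)
    (x : ℝ → ℝ) (hx : Continuous x)
    (y₁ z₁ y₂ z₂ : ℝ → ℝ)
    (hy₁ : ∀ t ≥ (0 : ℝ), HasDerivAt y₁ (ρ * x t - y₁ t - x t * z₁ t) t)
    (hz₁ : ∀ t ≥ (0 : ℝ), HasDerivAt z₁ (-β * z₁ t + x t * y₁ t) t)
    (hy₂ : ∀ t ≥ (0 : ℝ), HasDerivAt y₂ (ρ * x t - y₂ t - x t * z₂ t) t)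
    (hz₂ : ∀ t ≥ (0 : ℝ), HasDerivAt z₂ (-β * z₂ t + x t * y₂ t) t) :
    ∀ t ≥ (0 : ℝ),
      (y₁ t - y₂ t) ^ 2 + (z₁ t - z₂ t) ^ 2 ≤
        Real.exp (-2 * min 1 β * t) * ((y₁ 0 - y₂ 0) ^ 2 + (z₁ 0 - z₂ 0) ^ 2) := by
  intro t ht
  refine le_exp_mul_of_hasDerivAt_le (V := fun t => (y₁ t - y₂ t) ^ 2 + (z₁ t - z₂ t) ^ 2)
    (V' := fun t => -2 * (y₁ t - y₂ t) ^ 2 - 2 * β * (z₁ t - z₂ t) ^ 2)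
    (fun s hs => ?_) (fun s _ => ?_) ht
  · refine ((((hy₁ s hs).sub (hy₂ s hs)).pow 2).add
      (((hz₁ s hs).sub (hz₂ s hs)).pow 2)).congr_deriv ?_
    simp only [Pi.sub_apply]
    push_cast
    ring
  · have hy := mul_le_mul_of_nonneg_right (min_le_left 1 β) (sq_nonneg (y₁ s - y₂ s))
    have hz := mul_le_mul_of_nonneg_right (min_le_right 1 β) (sq_nonneg (z₁ s - z₂ s))
    linarith
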